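/- There exists n₀ ∈ ℕ such that for all n ≥ n₀: every permutation g of Z₂ⁿ that is a product of two disjoint transpositions can be realized by a reversible circuit with n inputs (no additional inputs), consisting of gates from Ωₙ², whose gate complexity is at most 12n + 364. -/

import Mathlib

namespace RevCirc

/-- A reversible gate on `n` wires: a target coordinate together with a set of
at most two control coordinates not containing the target.  With no controls it
is a NOT gate, with one control a CNOT gate and with two controls a 2-CNOT
(Toffoli) gate. -/
abbrev Gate (n : ℕ) : Type :=
  {p : Fin n × Finset (Fin n) // p.2.card ≤ 2 ∧ p.1 ∉ p.2}

def Gate.target {n : ℕ} (g : Gate n) : Fin n := g.1.1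

def Gate.controls {n : ℕ} (g : Gate n) : Finset (Fin n) := g.1.2

/-- The transformation of `ℤ₂ⁿ` defined by a gate: the target coordinate is
XOR-ed with the conjunction of the control coordinates. -/
def Gate.apply {n : ℕ} (g : Gate n) (x : Fin n → Bool) : Fin n → Bool :=
  fun i => if i = g.target then xor (x i) (decide (∀ j ∈ g.controls, x j = true)) else x i

/-- The transformation defined by a circuit (a list of gates, applied left to right). -/
def evalCircuit {n : ℕ} (c : List (Gate n)) (x : Fin n → Bool) : Fin n → Bool :=
  c.foldl (fun y g => g.apply y) x

/-- A circuit realizes a permutation `h` of `ℤ₂ⁿ` (without additional inputs) if the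
composition of its gates equals `h`. -/
def realizes {n : ℕ} (c : List (Gate n)) (h : Equiv.Perm (Fin n → Bool)) : Prop :=
  ∀ x, evalCircuit c x = h x

/-- The expanding function `ℤ₂ⁿ → ℤ₂^{n+q}` padding with zeros. -/
def expand (n q : ℕ) (x : Fin n → Bool) : Fin (n + q) → Bool :=
  fun i => if h : (i : ℕ) < n then x ⟨i, h⟩ else false

/-- A circuit with `n+q` inputs implements `f : ℤ₂ⁿ → ℤ₂ⁿ` using `q` additional
inputs if for some permutation `π` of the wires, the coordinates `π(1),…,π(n)` of the
output on the zero-padded input give `f`. -/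
def implements (n q : ℕ) (c : List (Gate (n + q)))
    (f : (Fin n → Bool) → (Fin n → Bool)) : Prop :=
  ∃ π : Equiv.Perm (Fin (n + q)), ∀ x : Fin n → Bool, ∀ i : Fin n,
    evalCircuit c (expand n q x) (π (Fin.castLE (Nat.le_add_right n q) i)) = f x i

/-- `F(n,q)`: the set of transformations `ℤ₂ⁿ → ℤ₂ⁿ` implementable by reversible
circuits with `n+q` inputs. -/
def FSet (n q : ℕ) : Set ((Fin n → Bool) → (Fin n → Bool)) :=
  {f | ∃ c : List (Gate (n + q)), implements n q c f}

/-- The set of wires touched by a gate: its target together with its controls. -/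
def Gate.support {n : ℕ} (g : Gate n) : Finset (Fin n) := insert g.target g.controls

/-- A circuit has depth 1 if the supports of its gates are pairwise disjoint. -/
def DepthOne {n : ℕ} (c : List (Gate n)) : Prop :=
  c.Pairwise fun g₁ g₂ => Disjoint g₁.support g₂.support

/-- The depth of a circuit: the minimal number of consecutive depth-1 sub-circuits
into which it can be divided. -/
noncomputable def depth {n : ℕ} (c : List (Gate n)) : ℕ :=
  sInf {d | ∃ parts : List (List (Gate n)),
    parts.flatten = c ∧ (∀ p ∈ parts, DepthOne p) ∧ parts.length = d}

/-- The quantum weight of a circuit: each NOT and CNOT gate weighs `WC`, each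
2-CNOT gate weighs `WT`. -/
def weight {n : ℕ} (WC WT : ℝ) (c : List (Gate n)) : ℝ :=
  (c.map fun g => if g.controls.card = 2 then WT else WC).sum

/-- `L(f,q)`: minimal gate complexity of a circuit implementing `f` with `q`
additional inputs. -/
noncomputable def Lmin (n q : ℕ) (f : (Fin n → Bool) → (Fin n → Bool)) : ℕ :=
  sInf {l | ∃ c : List (Gate (n + q)), implements n q c f ∧ c.length = l}

/-- The Shannon gate complexity function `L(n,q)`. -/
noncomputable def ShannonL (n q : ℕ) : ℕ := sSup (Lmin n q '' FSet n q)

/-- `D(f,q)`: minimal depth of a circuit implementing `f` with `q` additional inputs. -/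
noncomputable def Dmin (n q : ℕ) (f : (Fin n → Bool) → (Fin n → Bool)) : ℕ :=
  sInf {d | ∃ c : List (Gate (n + q)), implements n q c f ∧ depth c = d}

/-- The Shannon depth function `D(n,q)`. -/
noncomputable def ShannonD (n q : ℕ) : ℕ := sSup (Dmin n q '' FSet n q)

/-- `W(f,q)`: minimal quantum weight of a circuit implementing `f` with `q`
additional inputs. -/
noncomputable def Wmin (WC WT : ℝ) (n q : ℕ) (f : (Fin n → Bool) → (Fin n → Bool)) : ℝ :=
  sInf {w | ∃ c : List (Gate (n + q)), implements n q c f ∧ weight WC WT c = w}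

/-- The Shannon quantum weight function `W(n,q)`. -/
noncomputable def ShannonW (WC WT : ℝ) (n q : ℕ) : ℝ := sSup (Wmin WC WT n q '' FSet n q)

/-- A permutation is a product of `K` pairwise disjoint (independent) transpositions:
there are `2K` pairwise distinct points `x i, y i` with `g = (x 1, y 1)∘⋯∘(x K, y K)`. -/
def IsProdOfDisjointTranspositions {X : Type*} [DecidableEq X] (K : ℕ)
    (g : Equiv.Perm X) : Prop :=
  ∃ x y : Fin K → X,
    Function.Injective (Sum.elim x y) ∧
    g = ((List.finRange K).map fun i => Equiv.swap (x i) (y i)).prod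


/-! ### Basic facts on circuits -/

theorem eval_nil {n : ℕ} (x : Fin n → Bool) : evalCircuit ([] : List (Gate n)) x = x := rfl

theorem eval_append {n : ℕ} (c d : List (Gate n)) (x : Fin n → Bool) :
    evalCircuit (c ++ d) x = evalCircuit d (evalCircuit c x) := by
  simp [evalCircuit, List.foldl_append]

theorem eval_cons {n : ℕ} (g : Gate n) (d : List (Gate n)) (x : Fin n → Bool) :
    evalCircuit (g :: d) x = evalCircuit d (g.apply x) := rfl

theorem apply_apply {n : ℕ} (g : Gate n) (x : Fin n → Bool) : g.apply (g.apply x) = x := by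
  have hc : ∀ j ∈ g.controls, g.apply x j = x j := by
    intro j hj
    have : j ≠ g.target := by
      rintro rfl
      exact g.2.2 hj
    simp [Gate.apply, this]
  have hd : (∀ j ∈ g.controls, g.apply x j = true) ↔ (∀ j ∈ g.controls, x j = true) :=
    forall₂_congr fun j hj => by rw [hc j hj]
  funext i
  by_cases hi : i = g.target
  · have h1 : g.apply (g.apply x) i
        = xor (g.apply x i) (decide (∀ j ∈ g.controls, g.apply x j = true)) := by
      conv_lhs => unfold Gate.apply
      rw [if_pos hi]
      rfl
    have h2 : g.apply x i = xor (x i) (decide (∀ j ∈ g.controls, x j = true)) := by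
      unfold Gate.apply
      rw [if_pos hi]
    rw [h1, h2, decide_eq_decide.2 hd, Bool.xor_assoc, Bool.xor_self, Bool.xor_false]
  · simp [Gate.apply, hi]

theorem eval_reverse {n : ℕ} (c : List (Gate n)) (x : Fin n → Bool) :
    evalCircuit c.reverse (evalCircuit c x) = x := by
  induction c generalizing x with
  | nil => rfl
  | cons g c ih =>
    rw [List.reverse_cons, eval_append, eval_cons, eval_cons, ih, eval_nil, apply_apply]

theorem eval_reverse' {n : ℕ} (c : List (Gate n)) (x : Fin n → Bool) :
    evalCircuit c (evalCircuit c.reverse x) = x := by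
  have := eval_reverse c.reverse x
  rwa [List.reverse_reverse] at this

/-- Toffoli gate (possibly with equal controls). -/
def tof {n : ℕ} (u v t : Fin n) (hu : t ≠ u) (hv : t ≠ v) : Gate n :=
  ⟨(t, {u, v}), Finset.card_le_two, by simp [hu, hv]⟩

theorem tof_apply {n : ℕ} (u v t : Fin n) (hu : t ≠ u) (hv : t ≠ v) (x : Fin n → Bool)
    (i : Fin n) : (tof u v t hu hv).apply x i
      = if i = t then xor (x i) (x u && x v) else x i := by
  simp [tof, Gate.apply, Gate.target, Gate.controls]

/-! ### Gates on three wires generate everything -/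

def notG (i : Fin 3) : Gate 3 := ⟨(i, ∅), by simp, by simp⟩

def tofG (i : Fin 3) : Gate 3 := ⟨(i, Finset.univ.erase i), by simp, by simp⟩

def nots (i : Fin 3) (x : Fin 3 → Bool) : List (Gate 3) :=
  ((List.finRange 3).filter fun j => decide (j ≠ i) && !(x j)).map notG

set_option maxRecDepth 100000 in
theorem three_adj : ∀ (i : Fin 3) (x : Fin 3 → Bool) (z : Fin 3 → Bool),
    evalCircuit (nots i x ++ [tofG i] ++ nots i x) z
      = Equiv.swap x (Function.update x i (!(x i))) z := by
  decide

def realSub : Subgroup (Equiv.Perm (Fin 3 → Bool)) where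
  carrier := {σ | ∃ c : List (Gate 3), realizes c σ}
  one_mem' := ⟨[], fun _ => rfl⟩
  mul_mem' := by
    rintro σ τ ⟨c, hc⟩ ⟨d, hd⟩
    exact ⟨d ++ c, fun x => by rw [eval_append, hd, hc]; rfl⟩
  inv_mem' := by
    rintro σ ⟨c, hc⟩
    refine ⟨c.reverse, fun x => ?_⟩
    have := eval_reverse c (σ⁻¹ x)
    rw [hc] at this
    simpa using this

theorem swap_upd (x : Fin 3 → Bool) (i : Fin 3) (v : Bool) :
    Equiv.swap x (Function.update x i v) ∈ realSub := by
  by_cases h : v = x i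
  · subst h
    rw [Function.update_eq_self, Equiv.swap_self]
    exact one_mem realSub
  · have : v = !(x i) := by cases v <;> cases hx : x i <;> simp_all
    rw [this]
    exact ⟨_, three_adj i x⟩

theorem swap_trans {x y z : Fin 3 → Bool} (h1 : Equiv.swap x y ∈ realSub)
    (h2 : Equiv.swap y z ∈ realSub) : Equiv.swap x z ∈ realSub := by
  by_cases hxy : x = y
  · rwa [hxy]
  by_cases hxz : x = z
  · rw [hxz, Equiv.swap_self]; exact one_mem realSub
  rw [Equiv.swap_comm x z, ← Equiv.swap_mul_swap_mul_swap hxy hxz]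
  exact mul_mem (mul_mem h2 h1) h2

theorem three_swap (x y : Fin 3 → Bool) : Equiv.swap x y ∈ realSub := by
  have h0 := swap_upd x 0 (y 0)
  have h1 := swap_upd (Function.update x 0 (y 0)) 1 (y 1)
  have h2 := swap_upd (Function.update (Function.update x 0 (y 0)) 1 (y 1)) 2 (y 2)
  have : Function.update (Function.update (Function.update x 0 (y 0)) 1 (y 1)) 2 (y 2) = y := by
    funext i
    fin_cases i <;> simp [Function.update]
  rw [this] at h2
  exact swap_trans (swap_trans h0 h1) h2

theorem three_all (σ : Equiv.Perm (Fin 3 → Bool)) : ∃ c : List (Gate 3), realizes c σ := by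
  change σ ∈ realSub
  induction σ using Equiv.Perm.swap_induction_on with
  | one => exact one_mem realSub
  | swap_mul f x y _ hf => exact mul_mem (three_swap x y) hf

theorem three_bound : ∃ C : ℕ, ∀ σ : Equiv.Perm (Fin 3 → Bool),
    ∃ c : List (Gate 3), realizes c σ ∧ c.length ≤ C := by
  choose c hc using three_all
  exact ⟨Finset.univ.sup fun σ => (c σ).length, fun σ => ⟨c σ, hc σ,
    Finset.le_sup (f := fun σ => (c σ).length) (Finset.mem_univ σ)⟩⟩

def embG {n : ℕ} (ι : Fin 3 ↪ Fin n) (g : Gate 3) : Gate n :=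
  ⟨(ι g.1.1, g.1.2.map ι), by simpa using g.2.1, by simpa using g.2.2⟩

theorem embG_in {n : ℕ} (ι : Fin 3 ↪ Fin n) (g : Gate 3) (x : Fin n → Bool) (i : Fin 3) :
    (embG ι g).apply x (ι i) = g.apply (fun j => x (ι j)) i := by
  simp [embG, Gate.apply, Gate.target, Gate.controls]
  rfl

theorem embG_out {n : ℕ} (ι : Fin 3 ↪ Fin n) (g : Gate 3) (x : Fin n → Bool) (i : Fin n)
    (hi : ∀ k, i ≠ ι k) : (embG ι g).apply x i = x i := by
  simp [embG, Gate.apply, Gate.target, hi]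

theorem emb_in {n : ℕ} (ι : Fin 3 ↪ Fin n) (c : List (Gate 3)) (x : Fin n → Bool) (i : Fin 3) :
    evalCircuit (c.map (embG ι)) x (ι i) = evalCircuit c (fun j => x (ι j)) i := by
  induction c generalizing x with
  | nil => rfl
  | cons g c ih =>
    rw [List.map_cons, eval_cons, eval_cons, ih]
    congr 1
    funext j
    exact embG_in ι g x j

theorem emb_out {n : ℕ} (ι : Fin 3 ↪ Fin n) (c : List (Gate 3)) (x : Fin n → Bool) (i : Fin n)
    (hi : ∀ k, i ≠ ι k) : evalCircuit (c.map (embG ι)) x i = x i := by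
  induction c generalizing x with
  | nil => rfl
  | cons g c ih => rw [List.map_cons, eval_cons, ih, embG_out ι g x i hi]

theorem exists_perm_map {α : Type*} [Finite α] (q r : Fin 4 → α) (hq : Function.Injective q)
    (hr : Function.Injective r) : ∃ σ : Equiv.Perm α, ∀ k, σ (q k) = r k := by
  have := Equiv.Perm.isMultiplyPretransitive α 4
  obtain ⟨σ, hσ⟩ := MulAction.exists_smul_eq (Equiv.Perm α)
    (⟨q, hq⟩ : Fin 4 ↪ α) (⟨r, hr⟩ : Fin 4 ↪ α)
  exact ⟨σ, fun k => DFunLike.congr_fun hσ k⟩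

/-! ### Moving four points to standard position -/

theorem multi_cnot {n : ℕ} (u : Fin n) (S : Finset (Fin n)) (hS : u ∉ S) :
    ∃ c : List (Gate n), c.length ≤ S.card ∧
      ∀ x j, evalCircuit c x j = if j ∈ S then xor (x j) (x u) else x j := by
  induction S using Finset.induction_on with
  | empty => exact ⟨[], by simp, by simp [eval_nil]⟩
  | insert a S ha ih =>
    have hau : a ≠ u := by rintro rfl; simp at hS
    obtain ⟨c, hl, hc⟩ := ih (fun h => hS (by simp [h]))
    refine ⟨tof u u a hau hau :: c, by rw [Finset.card_insert_of_notMem ha]; simpa using hl, ?_⟩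
    intro x j
    rw [eval_cons, hc]
    simp only [tof_apply, hau.symm, if_false, Bool.and_self, Finset.mem_insert]
    by_cases h1 : j = a
    · subst h1; simp [ha]
    · simp [h1]

theorem separate {n : ℕ} (F : Finset (Fin n → Bool)) : ∃ S : Finset (Fin n),
    S.card ≤ F.card - 1 ∧ ∀ x ∈ F, ∀ y ∈ F, (∀ i ∈ S, x i = y i) → x = y := by
  induction F using Finset.induction_on with
  | empty => exact ⟨∅, by simp, by simp⟩
  | insert a F ha ih =>
    obtain ⟨S, hS, hsep⟩ := ih
    rw [Finset.card_insert_of_notMem ha]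
    by_cases h : ∃ y ∈ F, ∀ i ∈ S, a i = y i
    · obtain ⟨y, hy, hay⟩ := h
      have hne : a ≠ y := by rintro rfl; exact ha hy
      obtain ⟨i, hi⟩ := Function.ne_iff.1 hne
      have hF : 0 < F.card := Finset.card_pos.2 ⟨y, hy⟩
      refine ⟨insert i S, (Finset.card_insert_le _ _).trans (by omega), ?_⟩
      have key : ∀ z ∈ F, ¬ (∀ j ∈ insert i S, a j = z j) := by
        intro z hz hall
        have : y = z := hsep y hy z hz fun j hj => by
          rw [← hay j hj, hall j (Finset.mem_insert_of_mem hj)]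
        subst this
        exact hi (hall i (Finset.mem_insert_self _ _))
      intro x hx z hz hxz
      rw [Finset.mem_insert] at hx hz
      rcases hx with rfl | hx <;> rcases hz with rfl | hz
      · rfl
      · exact (key z hz hxz).elim
      · exact (key x hx fun j hj => (hxz j hj).symm).elim
      · exact hsep x hx z hz fun j hj => hxz j (Finset.mem_insert_of_mem hj)
    · push Not at h
      refine ⟨S, by omega, ?_⟩
      intro x hx z hz hxz
      rw [Finset.mem_insert] at hx hz
      rcases hx with rfl | hx <;> rcases hz with rfl | hz
      · rfl
      · obtain ⟨i, hi, hne⟩ := h z hz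
        exact (hne (hxz i hi)).elim
      · obtain ⟨i, hi, hne⟩ := h x hx
        exact (hne (hxz i hi).symm).elim
      · exact hsep x hx z hz hxz

theorem separate_three {n : ℕ} (hn : 3 ≤ n) (p : Fin 4 → Fin n → Bool)
    (hp : Function.Injective p) :
    ∃ ι : Fin 3 ↪ Fin n, Function.Injective fun k => fun j => p k (ι j) := by
  obtain ⟨S, hS, hsep⟩ := separate (Finset.univ.image p)
  rw [Finset.card_image_of_injective _ hp] at hS
  obtain ⟨T, hST, hT⟩ := Finset.exists_superset_card_eq (s := S) (n := 3)
    (by simpa using hS) (by simpa using hn)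
  refine ⟨(T.orderEmbOfFin hT).toEmbedding, fun k l hkl => hp ?_⟩
  refine hsep _ (by simp) _ (by simp) fun i hi => ?_
  have : i ∈ Set.range (T.orderEmbOfFin hT) := by
    rw [Finset.range_orderEmbOfFin]; exact hST hi
  obtain ⟨j, rfl⟩ := this
  exact congr_fun hkl j

/-- first bit of `k` -/
def bitT (k : Fin 4) : Bool := decide (k.1 % 2 = 1)
/-- second bit of `k` -/
def bitB (k : Fin 4) : Bool := decide (k.1 / 2 = 1)

theorem bits_inj : ∀ k l : Fin 4, bitT k = bitT l → bitB k = bitB l → k = l := by decide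

theorem standardize : ∃ C : ℕ, ∀ n : ℕ, 3 ≤ n → ∀ p : Fin 4 → Fin n → Bool,
    Function.Injective p → ∃ (b t : Fin n) (c : List (Gate n)), b ≠ t ∧ c.length ≤ n + C ∧
      ∀ k i, evalCircuit c (p k) i
        = if i = t then bitT k else if i = b then bitB k else true := by
  obtain ⟨C, hC⟩ := three_bound
  refine ⟨2 * C * 16 + C, fun n hn p hp => ?_⟩
  obtain ⟨ι, hι⟩ := separate_three hn p hp
  have hcirc : ∀ f : Fin 4 → Bool, ∃ c : List (Gate 3), c.length ≤ C ∧
      ∀ k, evalCircuit c (fun j => p k (ι j)) = ![bitT k, bitB k, f k] := by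
    intro f
    have hr : Function.Injective (fun k => (![bitT k, bitB k, f k] : Fin 3 → Bool)) := by
      intro k l h
      exact bits_inj k l (congr_fun h 0) (congr_fun h 1)
    obtain ⟨σ, hσ⟩ := exists_perm_map _ _ hι hr
    obtain ⟨c, hc, hl⟩ := hC σ
    exact ⟨c, hl, fun k => by rw [hc, hσ]⟩
  let pat : Fin n → Fin 4 → Bool := fun j k => p k j
  have loop : ∀ Φ : Finset (Fin 4 → Bool), ∃ c : List (Gate n),
      c.length ≤ 2 * C * Φ.card
        + (Finset.univ.filter fun j => (∀ k, j ≠ ι k) ∧ pat j ∈ Φ).card ∧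
      ∀ k j, evalCircuit c (p k) j
        = if (∀ k, j ≠ ι k) ∧ pat j ∈ Φ then true else p k j := by
    intro Φ
    induction Φ using Finset.induction_on with
    | empty => exact ⟨[], by simp, by simp [eval_nil]⟩
    | insert f Φ hf ih =>
      obtain ⟨c, hl, hc⟩ := ih
      obtain ⟨d, hdl, hd⟩ := hcirc (fun k => !(f k))
      let S : Finset (Fin n) := Finset.univ.filter fun j => (∀ k, j ≠ ι k) ∧ pat j = f
      obtain ⟨e, hel, he⟩ := multi_cnot (ι 2) S (by simp [S])
      refine ⟨c ++ (d.map (embG ι) ++ (e ++ (d.map (embG ι)).reverse)), ?_, ?_⟩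
      · have hcard : (Finset.univ.filter fun j => (∀ k, j ≠ ι k) ∧ pat j ∈ insert f Φ).card
            = (Finset.univ.filter fun j => (∀ k, j ≠ ι k) ∧ pat j ∈ Φ).card + S.card := by
          rw [← Finset.card_union_of_disjoint]
          · congr 1
            ext j
            simp only [Finset.mem_filter, Finset.mem_union, Finset.mem_insert, Finset.mem_univ, S]
            tauto
          · rw [Finset.disjoint_left]
            intro j hj hj'
            simp only [Finset.mem_filter, S] at hj hj'
            exact hf (hj'.2.2 ▸ hj.2.2)
        rw [hcard, Finset.card_insert_of_notMem hf]
        simp only [List.length_append, List.length_map, List.length_reverse]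
        nlinarith
      · intro k j
        rw [eval_append, eval_append, eval_append]
        set y := evalCircuit c (p k) with hy
        have hyι : (fun j => y (ι j)) = fun j => p k (ι j) := by
          funext j; rw [hy, hc]; simp
        set z := evalCircuit (d.map (embG ι)) y with hz
        have hz2 : z (ι 2) = !(f k) := by
          rw [hz, emb_in, hyι, hd]; rfl
        have hw : evalCircuit e z = evalCircuit (d.map (embG ι))
            (fun j => if (∀ k, j ≠ ι k) ∧ pat j ∈ insert f Φ then true else p k j) := by
          funext j
          rw [he, hz2]
          by_cases hj : ∀ k, j ≠ ι k
          · rw [hz, emb_out ι d y j hj, emb_out ι d _ j hj, hy, hc]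
            by_cases hjf : pat j = f
            · have : p k j = f k := congr_fun hjf k
              simp [S, hj, hjf, hf, this]
            · simp [S, hj, hjf]
          · push Not at hj
            obtain ⟨m, rfl⟩ := hj
            rw [if_neg (by simp [S]), hz, emb_in, emb_in]
            congr 1
            rw [hyι]
            funext i
            simp
        rw [hw, eval_reverse]
  obtain ⟨c, hl, hc⟩ := loop Finset.univ
  obtain ⟨d, hdl, hd⟩ := hcirc (fun _ => true)
  refine ⟨ι 1, ι 0, c ++ d.map (embG ι), by simp, ?_, ?_⟩
  · have h1 : (Finset.univ.filter fun j => (∀ k, j ≠ ι k) ∧ pat j ∈ Finset.univ).card ≤ n :=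
      (Finset.card_le_univ _).trans (by simp)
    have h2 : (Finset.univ : Finset (Fin 4 → Bool)).card = 16 := by simp
    rw [h2] at hl
    simp only [List.length_append, List.length_map]
    omega
  · intro k i
    rw [eval_append]
    by_cases hj : ∀ k, i ≠ ι k
    · rw [emb_out ι d _ i hj, hc]
      simp [hj]
    · push Not at hj
      obtain ⟨m, rfl⟩ := hj
      rw [emb_in]
      have : (fun j => evalCircuit c (p k) (ι j)) = fun j => p k (ι j) := by
        funext j; rw [hc]; simp
      rw [this, hd]
      fin_cases m <;> simp

/-! ### Multiply controlled NOT -/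

/-- The ladder: adds to every `a j`, `1 ≤ j ≤ k`, the product of `c 0, …, c j`. -/
theorem ladder {n : ℕ} (c a : ℕ → Fin n) (h0 : a 0 = c 0) (k : ℕ)
    (hca : ∀ i ≤ k, ∀ j, 1 ≤ j → j ≤ k → a j ≠ c i)
    (haa : ∀ i j, i < j → j ≤ k → a i ≠ a j) :
    ∃ L : List (Gate n), L.length ≤ 2 * k ∧
      (∀ x j, 1 ≤ j → j ≤ k → evalCircuit L x (a j)
        = xor (x (a j)) (decide (∀ l ≤ j, x (c l) = true))) ∧
      (∀ x i, (∀ j, 1 ≤ j → j ≤ k → i ≠ a j) → evalCircuit L x i = x i) := by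
  induction k with
  | zero => exact ⟨[], by simp, by intro x j h1 h2; omega, fun _ _ _ => rfl⟩
  | succ k ih =>
    obtain ⟨L, hl, hin, hout⟩ := ih
      (fun i hi j h1 h2 => hca i (by omega) j h1 (by omega))
      (fun i j h1 h2 => haa i j h1 (by omega))
    have hu : a (k + 1) ≠ c (k + 1) := hca _ le_rfl _ (by omega) le_rfl
    have hv : a (k + 1) ≠ a k := (haa k (k + 1) (by omega) le_rfl).symm
    have hk1 : ∀ j, 1 ≤ j → j ≤ k → a (k + 1) ≠ a j := fun j _ h2 =>
      (haa j (k + 1) (by omega) le_rfl).symm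
    have hcL : ∀ i ≤ k + 1, ∀ j, 1 ≤ j → j ≤ k → c i ≠ a j := fun i hi j h1 h2 =>
      (hca i hi j h1 (by omega)).symm
    rcases Nat.eq_zero_or_pos k with rfl | hk
    · refine ⟨[tof (c 1) (a 0) (a 1) hu hv], by simp, ?_, ?_⟩
      · intro x j h1 h2
        obtain rfl : j = 1 := by omega
        rw [eval_cons, eval_nil, tof_apply, if_pos rfl, h0]
        congr 1
        rw [Bool.eq_iff_iff]
        simp only [Bool.and_eq_true, decide_eq_true_eq]
        constructor
        · rintro ⟨h1, h2⟩ l hl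
          obtain rfl | rfl : l = 0 ∨ l = 1 := by omega
          · exact h2
          · exact h1
        · intro h
          exact ⟨h 1 (by omega), h 0 (by omega)⟩
      · intro x i hi
        rw [eval_cons, eval_nil, tof_apply, if_neg (hi 1 le_rfl le_rfl)]
    · let T := tof (c (k + 1)) (a k) (a (k + 1)) hu hv
      have hTc : ∀ x, ∀ i ≤ k + 1, T.apply x (c i) = x (c i) := fun x i hi => by
        rw [tof_apply, if_neg (hca i hi (k + 1) (by omega) le_rfl).symm]
      refine ⟨T :: (L ++ [T]), by simp; omega, ?_, ?_⟩
      · intro x j h1 h2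
        rw [eval_cons, eval_append, eval_cons, eval_nil]
        set y := T.apply x with hy
        have hyc : ∀ i ≤ k + 1, y (c i) = x (c i) := hTc x
        rw [tof_apply]
        by_cases hj : j = k + 1
        · subst hj
          rw [if_pos rfl, hout y (a (k + 1)) hk1, hout y (c (k + 1)) (hcL _ le_rfl),
            hin y k hk le_rfl, hyc _ le_rfl]
          have hyk : y (a k) = x (a k) := by rw [hy, tof_apply, if_neg hv.symm]
          have hyk1 : y (a (k + 1)) = xor (x (a (k + 1))) (x (c (k + 1)) && x (a k)) := by
            rw [hy, tof_apply, if_pos rfl]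
          have e1 : decide (∀ l ≤ k, y (c l) = true) = decide (∀ l ≤ k, x (c l) = true) :=
            decide_eq_decide.2 (forall₂_congr fun l hl => by rw [hyc l (by omega)])
          have e2 : decide (∀ l ≤ k + 1, x (c l) = true)
              = (x (c (k + 1)) && decide (∀ l ≤ k, x (c l) = true)) := by
            rw [Bool.eq_iff_iff]
            simp only [Bool.and_eq_true, decide_eq_true_eq]
            constructor
            · intro h
              exact ⟨h _ le_rfl, fun l hl => h l (by omega)⟩
            · rintro ⟨h1, h2⟩ l hl
              rcases Nat.lt_or_ge k l with h | h
              · obtain rfl : l = k + 1 := by omega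
                exact h1
              · exact h2 l h
          rw [hyk, hyk1, e1, e2]
          generalize decide (∀ l ≤ k, x (c l) = true) = D
          cases x (a (k + 1)) <;> cases x (c (k + 1)) <;> cases x (a k) <;> cases D <;> rfl
        · have hjk : j ≤ k := by omega
          rw [if_neg (hk1 j h1 hjk).symm, hin y j h1 hjk, hy, tof_apply,
            if_neg (hk1 j h1 hjk).symm]
          congr 1
          exact decide_eq_decide.2 (forall₂_congr fun l hl => by rw [hTc x l (by omega)])
      · intro x i hi
        have hik := hi (k + 1) (by omega) le_rfl
        rw [eval_cons, eval_append, eval_cons, eval_nil, tof_apply, if_neg hik,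
          hout _ i (fun j h1 h2 => hi j h1 (by omega)), tof_apply, if_neg hik]

/-- Multiply controlled NOT with target `a (k+1)`, controls `c 0, …, c (k+1)` and dirty
ancillas `a 1, …, a k`. -/
theorem mcnot {n : ℕ} (c a : ℕ → Fin n) (h0 : a 0 = c 0) (k : ℕ)
    (hca : ∀ i ≤ k + 1, ∀ j, 1 ≤ j → j ≤ k + 1 → a j ≠ c i)
    (haa : ∀ i j, i < j → j ≤ k + 1 → a i ≠ a j) :
    ∃ L : List (Gate n), L.length ≤ 4 * (k + 1) ∧
      ∀ x i, evalCircuit L x i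
        = if i = a (k + 1) then xor (x i) (decide (∀ l ≤ k + 1, x (c l) = true)) else x i := by
  obtain ⟨L, hl, hin, hout⟩ := ladder c a h0 (k + 1) hca haa
  obtain ⟨M, hm, hinM, houtM⟩ := ladder c a h0 k
      (fun i hi j h1 h2 => hca i (by omega) j h1 (by omega))
      (fun i j h1 h2 => haa i j h1 (by omega))
  refine ⟨L ++ M, by simp; omega, ?_⟩
  intro x i
  rw [eval_append]
  by_cases hi : i = a (k + 1)
  · subst hi
    rw [if_pos rfl, houtM _ _ (fun j _ h2 => (haa j (k + 1) (by omega) le_rfl).symm),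
      hin x _ (by omega) le_rfl]
  · rw [if_neg hi]
    by_cases hj : ∃ j, 1 ≤ j ∧ j ≤ k ∧ i = a j
    · obtain ⟨j, h1, h2, rfl⟩ := hj
      rw [hinM _ j h1 h2, hin x j h1 (by omega)]
      have : decide (∀ l ≤ j, evalCircuit L x (c l) = true)
          = decide (∀ l ≤ j, x (c l) = true) :=
        decide_eq_decide.2 (forall₂_congr fun l hl => by
          rw [hout x (c l) (fun m h3 h4 => (hca l (by omega) m h3 h4).symm)])
      rw [this, Bool.xor_assoc, Bool.xor_self, Bool.xor_false]
    · push Not at hj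
      rw [houtM _ i hj, hout x i]
      intro j h1 h2
      rcases Nat.lt_or_ge k j with h | h
      · obtain rfl : j = k + 1 := by omega
        exact hi
      · exact hj j h1 h

theorem exists_wires {n : ℕ} (hn : 2 ≤ n) (b t : Fin n) (hbt : b ≠ t) :
    ∃ w : ℕ → Fin n, w 0 = b ∧ w 1 = t ∧ (∀ i j, i < n → j < n → w i = w j → i = j) ∧
      ∀ m, ∃ i < n, w i = m := by
  let z0 : Fin n := ⟨0, by omega⟩
  let z1 : Fin n := ⟨1, by omega⟩
  have hz : z0 ≠ z1 := by simp [z0, z1]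
  obtain ⟨e, he0, he1⟩ : ∃ e : Equiv.Perm (Fin n), e z0 = b ∧ e z1 = t := by
    refine ⟨Equiv.swap (Equiv.swap z0 b z1) t * Equiv.swap z0 b, ?_, ?_⟩
    · rw [Equiv.Perm.mul_apply, Equiv.swap_apply_left]
      refine Equiv.swap_apply_of_ne_of_ne ?_ hbt
      intro h
      have : Equiv.swap z0 b z0 = Equiv.swap z0 b z1 := by rw [Equiv.swap_apply_left, ← h]
      exact hz ((Equiv.swap z0 b).injective this)
    · rw [Equiv.Perm.mul_apply, Equiv.swap_apply_left]
  refine ⟨fun i => if h : i < n then e ⟨i, h⟩ else b, ?_, ?_, ?_, ?_⟩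
  · simpa [show 0 < n by omega] using he0
  · simpa [show 1 < n by omega] using he1
  · intro i j hi hj h
    simpa [hi, hj] using h
  · intro m
    exact ⟨(e.symm m).1, (e.symm m).2, by simp⟩

/-- NOT with `n-2` controls (all wires but `b` and `t`), using `b` as a dirty ancilla. -/
theorem big_cnot {n : ℕ} (hn : 10 ≤ n) (b t : Fin n) (hbt : b ≠ t) :
    ∃ L : List (Gate n), L.length ≤ 8 * n ∧
      ∀ x i, evalCircuit L x i = if i = t then
        xor (x i) (decide (∀ j, j ≠ b → j ≠ t → x j = true)) else x i := by
  obtain ⟨w, hw0, hw1, winj, wsurj⟩ := exists_wires (by omega) b t hbt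
  -- controls are split: `w 2, …, w (s+3)` and `w (s+4), …, w (n-1)`, `n = s + 6 + r`
  obtain ⟨s, r, hsr, h1, h2⟩ : ∃ s r : ℕ, n = s + 6 + r ∧ s ≤ r + 2 ∧ r ≤ s + 1 :=
    ⟨(n - 6) / 2, n - 6 - (n - 6) / 2, by omega, by omega, by omega⟩
  have wne : ∀ i j, i < n → j < n → i ≠ j → w i ≠ w j := fun i j hi hj h e =>
    h (winj i j hi hj e)
  -- first block: controls `w 2 .. w (s+3)`, target `b`
  let c1 : ℕ → Fin n := fun i => w (i + 2)
  let a1 : ℕ → Fin n := fun i =>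
    w (if i = 0 then 2 else if i = s + 1 then 0 else s + 3 + i)
  obtain ⟨L, hl, hL⟩ := mcnot c1 a1 (by simp [c1, a1]) s
    (by
      intro i hi j hj1 hj2
      simp only [c1, a1]
      apply wne <;> (try split_ifs) <;> omega)
    (by
      intro i j hij hj
      simp only [a1]
      apply wne <;> (try split_ifs) <;> omega)
  -- second block: controls `w 0, w (s+4) .. w (s+5+r)`, target `t`
  let c2 : ℕ → Fin n := fun i => w (if i = 0 then 0 else s + 3 + i)
  let a2 : ℕ → Fin n := fun i =>
    w (if i = 0 then 0 else if i = r + 2 then 1 else i + 1)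
  obtain ⟨M, hm, hM⟩ := mcnot c2 a2 (by simp [c2, a2]) (r + 1)
    (by
      intro i hi j hj1 hj2
      simp only [c2, a2]
      apply wne <;> (try split_ifs) <;> omega)
    (by
      intro i j hij hj
      simp only [a2]
      apply wne <;> (try split_ifs) <;> omega)
  have ha1 : a1 (s + 1) = b := by simp [a1, hw0]
  have ha2 : a2 (r + 1 + 1) = t := by simp [a2, hw1]
  rw [ha1] at hL
  rw [ha2] at hM
  let A : (Fin n → Bool) → Bool := fun x => decide (∀ l ≤ s + 1, x (c1 l) = true)
  let B : (Fin n → Bool) → Bool := fun x => decide (∀ l ≤ r + 1 + 1, 1 ≤ l → x (c2 l) = true)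
  have hMB : ∀ x, decide (∀ l ≤ r + 1 + 1, x (c2 l) = true) = (x b && B x) := by
    intro x
    rw [Bool.eq_iff_iff]
    simp only [B, Bool.and_eq_true, decide_eq_true_eq]
    constructor
    · intro h
      refine ⟨?_, fun l hl _ => h l hl⟩
      have := h 0 (by omega)
      simpa [c2, hw0] using this
    · rintro ⟨hb, h⟩ l hl
      rcases Nat.eq_zero_or_pos l with rfl | hp
      · simpa [c2, hw0] using hb
      · exact h l hl hp
  have hAB : ∀ x, decide (∀ j, j ≠ b → j ≠ t → x j = true) = (A x && B x) := by
    intro x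
    rw [Bool.eq_iff_iff]
    simp only [A, B, Bool.and_eq_true, decide_eq_true_eq]
    constructor
    · intro h
      constructor
      · intro l hl
        apply h
        · rw [← hw0]; apply wne <;> omega
        · rw [← hw1]; apply wne <;> omega
      · intro l hl hl1
        apply h
        · rw [← hw0]; apply wne <;> (try split_ifs) <;> omega
        · rw [← hw1]; apply wne <;> (try split_ifs) <;> omega
    · rintro ⟨hA, hB⟩ j hjb hjt
      obtain ⟨i, hi, rfl⟩ := wsurj j
      have hi0 : i ≠ 0 := by rintro rfl; exact hjb hw0
      have hi1 : i ≠ 1 := by rintro rfl; exact hjt hw1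
      by_cases hs : i ≤ s + 3
      · have := hA (i - 2) (by omega)
        simpa [c1, show i - 2 + 2 = i by omega] using this
      · have := hB (i - (s + 3)) (by omega) (by omega)
        simpa [c2, show i - (s + 3) ≠ 0 by omega, show s + 3 + (i - (s + 3)) = i by omega]
          using this
  have hc1 : ∀ l ≤ s + 1, c1 l ≠ b ∧ c1 l ≠ t := by
    intro l hl
    constructor
    · rw [← hw0]; apply wne <;> omega
    · rw [← hw1]; apply wne <;> omega
  have hc2 : ∀ l, 1 ≤ l → l ≤ r + 1 + 1 → c2 l ≠ b ∧ c2 l ≠ t := by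
    intro l hl1 hl
    constructor
    · rw [← hw0]; apply wne <;> (try split_ifs) <;> omega
    · rw [← hw1]; apply wne <;> (try split_ifs) <;> omega
  have hcongr : ∀ x y : Fin n → Bool, (∀ i, i ≠ b → i ≠ t → x i = y i) → A x = A y ∧ B x = B y := by
    intro x y h
    constructor
    · exact decide_eq_decide.2 (forall₂_congr fun l hl => by
        rw [h _ (hc1 l hl).1 (hc1 l hl).2])
    · exact decide_eq_decide.2 (forall₂_congr fun l hl => forall_congr' fun hl1 => by
        rw [h _ (hc2 l hl1 hl).1 (hc2 l hl1 hl).2])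
  have hL' : ∀ x i, evalCircuit L x i = if i = b then xor (x i) (A x) else x i := hL
  have hM' : ∀ x i, evalCircuit M x i = if i = t then xor (x i) (x b && B x) else x i := by
    intro x i; rw [hM, hMB]
  refine ⟨L ++ (M ++ (L ++ M)), by simp; omega, ?_⟩
  intro x i
  rw [eval_append, eval_append, eval_append, hAB]
  set x1 := evalCircuit L x with hx1
  set x2 := evalCircuit M x1 with hx2
  set x3 := evalCircuit L x2 with hx3
  have g1 : ∀ i, i ≠ b → i ≠ t → x1 i = x i := fun i hb ht => by rw [hx1, hL', if_neg hb]
  have g2 : ∀ i, i ≠ b → i ≠ t → x2 i = x i := fun i hb ht => by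
    rw [hx2, hM', if_neg ht, g1 i hb ht]
  have g3 : ∀ i, i ≠ b → i ≠ t → x3 i = x i := fun i hb ht => by
    rw [hx3, hL', if_neg hb, g2 i hb ht]
  have b1 : x1 b = xor (x b) (A x) := by rw [hx1, hL', if_pos rfl]
  have b2 : x2 b = xor (x b) (A x) := by rw [hx2, hM', if_neg hbt, b1]
  have b3 : x3 b = x b := by
    rw [hx3, hL', if_pos rfl, b2, (hcongr x2 x g2).1, Bool.xor_assoc, Bool.xor_self,
      Bool.xor_false]
  have t1 : x1 t = x t := by rw [hx1, hL', if_neg hbt.symm]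
  have t2 : x2 t = xor (x t) (xor (x b) (A x) && B x) := by
    rw [hx2, hM', if_pos rfl, t1, b1, (hcongr x1 x g1).2]
  have t3 : x3 t = xor (x t) (xor (x b) (A x) && B x) := by
    rw [hx3, hL', if_neg hbt.symm, t2]
  rw [hM']
  by_cases hit : i = t
  · subst hit
    rw [if_pos rfl, if_pos rfl, t3, b3, (hcongr x3 x g3).2]
    generalize A x = α
    generalize B x = β
    cases x i <;> cases x b <;> cases α <;> cases β <;> rfl
  · rw [if_neg hit, if_neg hit]
    by_cases hib : i = b
    · rw [hib, b3]
    · exact g3 i hib hit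

/-- Standard points. -/
def stdPt {n : ℕ} (b t : Fin n) (k : Fin 4) : Fin n → Bool :=
  fun i => if i = t then bitT k else if i = b then bitB k else true

theorem std_inj {n : ℕ} (b t : Fin n) (hbt : b ≠ t) : Function.Injective (stdPt b t) := by
  intro k l h
  refine bits_inj k l ?_ ?_
  · simpa [stdPt] using congr_fun h t
  · simpa [stdPt, hbt] using congr_fun h b

theorem std_swap {n : ℕ} (b t : Fin n) (hbt : b ≠ t) (F : (Fin n → Bool) → (Fin n → Bool))
    (hF : ∀ x i, F x i = if i = t then
        xor (x i) (decide (∀ j, j ≠ b → j ≠ t → x j = true)) else x i) (x : Fin n → Bool) :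
    F x = (Equiv.swap (stdPt b t 0) (stdPt b t 1) * Equiv.swap (stdPt b t 2) (stdPt b t 3)) x := by
  have hne : ∀ k l, k ≠ l → stdPt b t k ≠ stdPt b t l := fun k l h e => h (std_inj b t hbt e)
  have hFk : ∀ k l, bitB k = bitB l → bitT l = !(bitT k) → F (stdPt b t k) = stdPt b t l := by
    intro k l h1 h2
    funext i
    rw [hF]
    have : ∀ j, j ≠ b → j ≠ t → stdPt b t k j = true := by
      intro j hb ht
      simp [stdPt, hb, ht]
    rw [decide_eq_true this]
    by_cases hi : i = t
    · simp [stdPt, hi, h2]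
    · simp [stdPt, hi, h1]
  rw [Equiv.Perm.mul_apply]
  by_cases h : ∃ k, x = stdPt b t k
  · obtain ⟨k, rfl⟩ := h
    fin_cases k
    · change F (stdPt b t 0) = Equiv.swap _ _ (Equiv.swap _ _ (stdPt b t 0))
      rw [hFk 0 1 rfl rfl, Equiv.swap_apply_of_ne_of_ne (a := stdPt b t 2)
        (hne _ _ (by decide)) (hne _ _ (by decide)), Equiv.swap_apply_left]
    · change F (stdPt b t 1) = Equiv.swap _ _ (Equiv.swap _ _ (stdPt b t 1))
      rw [hFk 1 0 rfl rfl, Equiv.swap_apply_of_ne_of_ne (a := stdPt b t 2)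
        (hne _ _ (by decide)) (hne _ _ (by decide)), Equiv.swap_apply_right]
    · change F (stdPt b t 2) = Equiv.swap _ _ (Equiv.swap _ _ (stdPt b t 2))
      rw [hFk 2 3 rfl rfl, Equiv.swap_apply_left, Equiv.swap_apply_of_ne_of_ne
        (hne _ _ (by decide)) (hne _ _ (by decide))]
    · change F (stdPt b t 3) = Equiv.swap _ _ (Equiv.swap _ _ (stdPt b t 3))
      rw [hFk 3 2 rfl rfl, Equiv.swap_apply_right, Equiv.swap_apply_of_ne_of_ne
        (hne _ _ (by decide)) (hne _ _ (by decide))]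
  · have hx : ¬ ∀ j, j ≠ b → j ≠ t → x j = true := by
      intro hall
      apply h
      have key : ∀ u v : Bool, ∃ k : Fin 4, bitT k = u ∧ bitB k = v := by decide
      obtain ⟨k, h1, h2⟩ := key (x t) (x b)
      refine ⟨k, funext fun i => ?_⟩
      by_cases hit : i = t
      · simp [stdPt, hit, h1]
      · by_cases hib : i = b
        · simp [stdPt, hib, hbt, h2]
        · simp [stdPt, hit, hib, hall i hib hit]
    push Not at h
    rw [Equiv.swap_apply_of_ne_of_ne (a := stdPt b t 2) (h 2) (h 3),
      Equiv.swap_apply_of_ne_of_ne (h 0) (h 1)]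
    funext i
    rw [hF, decide_eq_false hx]
    simp

end RevCirc


/-- Theorem: for large enough `n`, every product of two disjoint transpositions on `ℤ₂ⁿ`
is realized by a circuit without additional inputs with at most `12n + 364` gates. -/
theorem gate_complexity_of_two_disjoint_transpositions :
    ∃ n₀ : ℕ, ∀ n : ℕ, n ≥ n₀ → ∀ g : Equiv.Perm (Fin n → Bool),
      RevCirc.IsProdOfDisjointTranspositions 2 g →
      ∃ c : List (RevCirc.Gate n), RevCirc.realizes c g ∧ c.length ≤ 12 * n + 364 := by
  obtain ⟨C, hC⟩ := RevCirc.standardize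
  refine ⟨C + 10, fun n hn g hg => ?_⟩
  obtain ⟨x, y, hinj, rfl⟩ := hg
  have hp : Function.Injective (![x 0, y 0, x 1, y 1] : Fin 4 → Fin n → Bool) := by
    have hφ : Function.Injective
        (![Sum.inl 0, Sum.inr 0, Sum.inl 1, Sum.inr 1] : Fin 4 → Fin 2 ⊕ Fin 2) := by decide
    have := hinj.comp hφ
    convert this using 1
    funext k
    fin_cases k <;> rfl
  obtain ⟨b, t, P, hbt, hPl, hP⟩ := hC n (by omega) _ hp
  obtain ⟨L, hl, hL⟩ := RevCirc.big_cnot (by omega) b t hbt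
  have hPk : ∀ k, RevCirc.evalCircuit P ((![x 0, y 0, x 1, y 1] : Fin 4 → Fin n → Bool) k)
      = RevCirc.stdPt b t k := fun k => funext fun i => hP k i
  let e : Equiv.Perm (Fin n → Bool) :=
    ⟨RevCirc.evalCircuit P, RevCirc.evalCircuit P.reverse, RevCirc.eval_reverse P,
      RevCirc.eval_reverse' P⟩
  refine ⟨P ++ (L ++ P.reverse), ?_, by simp; omega⟩
  intro z
  rw [RevCirc.eval_append, RevCirc.eval_append]
  rw [RevCirc.std_swap b t hbt (RevCirc.evalCircuit L) hL]
  have h0 : e (x 0) = RevCirc.stdPt b t 0 := hPk 0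
  have h1 : e (y 0) = RevCirc.stdPt b t 1 := hPk 1
  have h2 : e (x 1) = RevCirc.stdPt b t 2 := hPk 2
  have h3 : e (y 1) = RevCirc.stdPt b t 3 := hPk 3
  change e.symm ((Equiv.swap (RevCirc.stdPt b t 0) (RevCirc.stdPt b t 1)
    * Equiv.swap (RevCirc.stdPt b t 2) (RevCirc.stdPt b t 3)) (e z)) = _
  rw [Equiv.symm_apply_eq, ← h0, ← h1, ← h2, ← h3]
  have hprod : ((List.finRange 2).map fun i => Equiv.swap (x i) (y i)).prod
      = Equiv.swap (x 0) (y 0) * Equiv.swap (x 1) (y 1) := by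
    simp [List.finRange_succ]
  rw [hprod, Equiv.Perm.mul_apply, Equiv.Perm.mul_apply, e.injective.map_swap, e.injective.map_swap]
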